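/- Let p ≥ 2, n = 3p−1, M = (1/3)·C(n−2,2), and let b, c be non-negative integers with b + c ≤ p−2. For i ∈ ℤ let ī denote the unique element of [n] with ī ≡ i (mod n). Let Σ = ⟨{ {ī, (i+1)¯, (i+2)¯} : i=1,…,n }⟩, for i=1,…,n and j=1,…,p−2 let Δ(i,j) = ⟨{ī, (i+1)¯, (i+2+3j)¯}, {(i+1+3j)¯, (i+2+3j)¯, (i+1)¯}⟩, let L = {Δ(i,j)} and M' = L ∖ {Δ(1,1),…,Δ(1,b)}, and let Γ = Σ ∪ (⋃_{Δ(i,j)∈M'} Δ(i,j)). For j = 1,…,p−2 let G_j = {1, 2+3j, 3+3j}, and for k = 0,1,…,c let Δ_k = Γ ∪ ⟨G_{b+1}⟩ ∪ ⋯ ∪ ⟨G_{b+k}⟩. Then for every k = 0,1,…,c, the simplicial complex Δ_k is connected, Buchsbaum, and h(Δ_k) = (1, n−3, 3(M−b), −(M−b)+k). -/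

import Mathlib

open Finset

noncomputable section

/-- `Δ` is a simplicial complex on `[n] = {1,…,n}`: a collection of subsets of `[n]`,
closed under taking subsets, containing every singleton `{i}` for `i ∈ [n]`. -/
def IsComplexOn (n : ℕ) (Δ : Finset (Finset ℕ)) : Prop :=
  (∀ F ∈ Δ, ∀ G ⊆ F, G ∈ Δ) ∧
  (∀ F ∈ Δ, ∀ i ∈ F, i ∈ Finset.Icc 1 n) ∧
  (∀ i ∈ Finset.Icc 1 n, ({i} : Finset ℕ) ∈ Δ)

/-- a simplicial complex whose vertex set is contained in `[n]`:
a downward closed collection of subsets of `[n]`. -/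
def IsComplexIn (n : ℕ) (Δ : Finset (Finset ℕ)) : Prop :=
  (∀ F ∈ Δ, ∀ G ⊆ F, G ∈ Δ) ∧ (∀ F ∈ Δ, ∀ i ∈ F, i ∈ Finset.Icc 1 n)

/-- the faces of `Δ` with `m` vertices -/
def facesOf (Δ : Finset (Finset ℕ)) (m : ℕ) : Finset (Finset ℕ) :=
  Δ.filter fun F => F.card = m

/-- `fVec Δ j = f_{j-1}(Δ)`, the number of faces of `Δ` with `j` vertices;
by convention `f_{-1}(Δ) = 1`. -/
def fVec (Δ : Finset (Finset ℕ)) (j : ℕ) : ℤ :=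
  if j = 0 then 1 else ((facesOf Δ j).card : ℤ)

/-- the `h`-vector of a `(d-1)`-dimensional complex, defined by
`∑ f_{i-1} (x-1)^{d-i} = ∑ h_i x^{d-i}`, i.e.
`h_i = ∑_{j=0}^{i} (-1)^{i-j} C(d-j, i-j) f_{j-1}`. -/
def hVec (d : ℕ) (Δ : Finset (Finset ℕ)) (i : ℕ) : ℤ :=
  ∑ j ∈ Finset.range (i + 1),
    (-1 : ℤ) ^ (i - j) * ((d - j).choose (i - j) : ℤ) * fVec Δ j

/-- the dimension `max {k : f_k(Δ) ≠ 0}` of `Δ`, as an integer -/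
def dimZ (Δ : Finset (Finset ℕ)) : ℤ := ((Δ.sup Finset.card : ℕ) : ℤ) - 1

/-- the link `lk_Δ(F) = {G : G ∩ F = ∅, G ∪ F ∈ Δ}` -/
def link (Δ : Finset (Finset ℕ)) (F : Finset ℕ) : Finset (Finset ℕ) :=
  Δ.filter fun G => Disjoint G F ∧ G ∪ F ∈ Δ

variable (K : Type) [Field K]

/-- the simplicial boundary operator on formal `K`-linear combinations of
finite subsets of `ℕ` (vertices ordered by the order on `ℕ`):
`∂ F = ∑_{v ∈ F} (-1)^{#{u ∈ F : u < v}} (F \ {v})`. -/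
def bdry : (Finset ℕ →₀ K) →ₗ[K] (Finset ℕ →₀ K) :=
  Finsupp.lsum K fun F => LinearMap.toSpanSingleton K (Finset ℕ →₀ K)
    (∑ v ∈ F, ((-1 : K) ^ ((F.filter fun u => u < v).card)) • Finsupp.single (F.erase v) (1 : K))

/-- the space of simplicial `K`-chains of `Δ` spanned by the faces with `m` vertices
(for `m = 0` this is the span of the empty face, giving *reduced* homology) -/
def chains (Δ : Finset (Finset ℕ)) (m : ℕ) : Submodule K (Finset ℕ →₀ K) :=
  Submodule.span K ((fun F => Finsupp.single F (1 : K)) '' (facesOf Δ m : Set (Finset ℕ)))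

/-- the dimension of the reduced homology of `Δ` at faces of cardinality `m`:
`dim (ker ∂ ∩ C_m) - dim (∂ C_{m+1})` -/
def homDim (Δ : Finset (Finset ℕ)) (m : ℕ) : ℕ :=
  Module.finrank K ↥(chains K Δ m ⊓ LinearMap.ker (bdry K))
    - Module.finrank K ↥((chains K Δ (m + 1)).map (bdry K))

/-- the reduced Betti number `β_i(Δ; K) = dim_K H̃_i(Δ; K)` for `i : ℤ` -/
def betti (Δ : Finset (Finset ℕ)) (i : ℤ) : ℕ :=
  if 0 ≤ i + 1 then homDim K Δ (i + 1).toNat else 0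

/-- all facets (maximal faces) of `Δ` have the same cardinality -/
def IsPure (Δ : Finset (Finset ℕ)) : Prop :=
  ∀ F ∈ Δ, (∀ G ∈ Δ, F ⊆ G → F = G) → F.card = Δ.sup Finset.card

/-- `Δ` is Cohen–Macaulay (over `K`): for every face `F ∈ Δ` (including `∅`),
`β_i(lk_Δ(F)) = 0` for all `i ≠ dim Δ - |F|`. -/
def IsCohenMacaulay (Δ : Finset (Finset ℕ)) : Prop :=
  ∀ F ∈ Δ, ∀ i : ℤ, i ≠ dimZ Δ - F.card → betti K (link Δ F) i = 0

/-- `Δ` is Buchsbaum (over `K`): `Δ` is pure and the link of every vertex is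
Cohen–Macaulay. -/
def IsBuchsbaum (Δ : Finset (Finset ℕ)) : Prop :=
  IsPure Δ ∧ ∀ v : ℕ, ({v} : Finset ℕ) ∈ Δ → IsCohenMacaulay K (link Δ {v})

/-- `Δ` is connected: any two vertices are joined by a path of edges of `Δ` -/
def IsConnectedComplex (Δ : Finset (Finset ℕ)) : Prop :=
  ∀ u v : ℕ, ({u} : Finset ℕ) ∈ Δ → ({v} : Finset ℕ) ∈ Δ →
    Relation.ReflTransGen (fun a b : ℕ => a ≠ b ∧ ({a, b} : Finset ℕ) ∈ Δ) u v

/-- `Δ` is link-acyclic: `β_i(lk_Δ(v)) = 0` for every vertex `v` of `Δ` and every `i` -/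
def IsLinkAcyclic (Δ : Finset (Finset ℕ)) : Prop :=
  ∀ v : ℕ, ({v} : Finset ℕ) ∈ Δ → ∀ i : ℤ, betti K (link Δ {v}) i = 0

/-- `Δ` is `2`-dimensional with `h`-vector `(a, b, c, e)` -/
def hVector3 (Δ : Finset (Finset ℕ)) (a b c e : ℤ) : Prop :=
  hVec 3 Δ 0 = a ∧ hVec 3 Δ 1 = b ∧ hVec 3 Δ 2 = c ∧ hVec 3 Δ 3 = e

/-- `macaulay2 a = a^⟨2⟩`: if `a = C(b,2) + r` is the (greedy) `2`-nd Macaulay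
representation (`b` maximal with `C(b,2) ≤ a`, `0 ≤ r < b`, `r = C(r,1)`), then
`a^⟨2⟩ = C(b+1,3) + C(r+1,2)`, and `0^⟨2⟩ = 0`. -/
def macaulay2 (a : ℕ) : ℕ :=
  if a = 0 then 0
  else
    (Nat.findGreatest (fun t => t.choose 2 ≤ a) (a + 2) + 1).choose 3
      + (a - (Nat.findGreatest (fun t => t.choose 2 ≤ a) (a + 2)).choose 2 + 1).choose 2

/-- `modRep n i = ī`, the unique element of `[n] = {1,…,n}` congruent to `i` mod `n` -/
def modRep (n : ℕ) (i : ℤ) : ℕ := ((i - 1) % (n : ℤ)).toNat + 1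


/-- `Σ` for `n = 3p-1`: generated by `{ī, (i+1)¯, (i+2)¯}`, `i = 1,…,n` -/
def SigmaA (p : ℕ) : Finset (Finset ℕ) :=
  (Finset.Icc 1 (3 * p - 1)).biUnion fun i =>
    ({modRep (3 * p - 1) (i : ℤ), modRep (3 * p - 1) ((i : ℤ) + 1),
      modRep (3 * p - 1) ((i : ℤ) + 2)} : Finset ℕ).powerset

/-- `Δ(i,j)` for `n = 3p-1`: generated by `{ī, (i+1)¯, (i+2+3j)¯}` and
`{(i+1+3j)¯, (i+2+3j)¯, (i+1)¯}` -/
def DeltaA (p i j : ℕ) : Finset (Finset ℕ) :=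
  ({modRep (3 * p - 1) (i : ℤ), modRep (3 * p - 1) ((i : ℤ) + 1),
    modRep (3 * p - 1) ((i : ℤ) + 2 + 3 * (j : ℤ))} : Finset ℕ).powerset ∪
  ({modRep (3 * p - 1) ((i : ℤ) + 1 + 3 * (j : ℤ)),
    modRep (3 * p - 1) ((i : ℤ) + 2 + 3 * (j : ℤ)),
    modRep (3 * p - 1) ((i : ℤ) + 1)} : Finset ℕ).powerset

open Classical in
/-- `Γ = Σ ∪ ⋃_{Δ(i,j) ∈ L ∖ {Δ(1,1),…,Δ(1,b)}} Δ(i,j)` for `n = 3p-1` -/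
def GammaA (p b : ℕ) : Finset (Finset ℕ) :=
  SigmaA p ∪ ((((Finset.Icc 1 (3 * p - 1)) ×ˢ (Finset.Icc 1 (p - 2))).filter
    fun q : ℕ × ℕ => ∀ j' ∈ Finset.Icc 1 b, DeltaA p q.1 q.2 ≠ DeltaA p 1 j').biUnion
      fun q => DeltaA p q.1 q.2)

/-- `G_j = {1, 2+3j, 3+3j}` -/
def GA (j : ℕ) : Finset ℕ := {1, 2 + 3 * j, 3 + 3 * j}

/-- `Δ_k = Γ ∪ ⟨G_{b+1}⟩ ∪ ⋯ ∪ ⟨G_{b+k}⟩` -/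
def DeltaAk (p b k : ℕ) : Finset (Finset ℕ) :=
  GammaA p b ∪ (Finset.Icc (b + 1) (b + k)).biUnion fun j => (GA j).powerset

end

section Homology

variable {K : Type} [Field K]

lemma bdry_single (F : Finset ℕ) :
    bdry K (Finsupp.single F 1) =
      ∑ v ∈ F, ((-1 : K) ^ ((F.filter fun u => u < v).card)) • Finsupp.single (F.erase v) (1 : K) := by
  simp [bdry]

lemma bdry_vertex (v : ℕ) :
    bdry K (Finsupp.single {v} 1) = Finsupp.single ∅ 1 := by
  rw [bdry_single]
  simp [Finset.filter_singleton]

lemma bdry_edge {a b : ℕ} (h : a < b) :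
    bdry K (Finsupp.single {a, b} 1) = Finsupp.single {b} 1 - Finsupp.single {a} 1 := by
  have h1 : ({a, b} : Finset ℕ).erase a = {b} := by
    ext x; simp; omega
  have h2 : ({a, b} : Finset ℕ).erase b = {a} := by
    ext x; simp; omega
  have h3 : ({a, b} : Finset ℕ).filter (fun u => u < a) = ∅ := by
    ext x; simp; omega
  have h4 : ({a, b} : Finset ℕ).filter (fun u => u < b) = {a} := by
    ext x; simp; omega
  rw [bdry_single, Finset.sum_pair h.ne, h1, h2, h3, h4]
  simp [sub_eq_add_neg]

instance chains_finite (Δ : Finset (Finset ℕ)) (m : ℕ) : FiniteDimensional K (chains K Δ m) :=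
  FiniteDimensional.span_of_finite K (((facesOf Δ m).finite_toSet).image _)

lemma single_mem_chains {Δ : Finset (Finset ℕ)} {F : Finset ℕ} (h : F ∈ Δ) :
    Finsupp.single F (1 : K) ∈ chains K Δ F.card :=
  Submodule.subset_span ⟨F, by simp [facesOf, h], rfl⟩

lemma homDim_eq_zero_of_le {Δ : Finset (Finset ℕ)} {m : ℕ}
    (h : chains K Δ m ⊓ LinearMap.ker (bdry K) ≤ (chains K Δ (m + 1)).map (bdry K)) :
    homDim K Δ m = 0 :=
  Nat.sub_eq_zero_of_le (Submodule.finrank_mono h)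

lemma homDim_eq_zero_of_card_ne {Δ : Finset (Finset ℕ)} {m : ℕ} (h : ∀ F ∈ Δ, F.card ≠ m) :
    homDim K Δ m = 0 := by
  have h0 : facesOf Δ m = ∅ := Finset.filter_eq_empty_iff.2 fun F hF => h F hF
  apply homDim_eq_zero_of_le
  simp [chains, h0]

lemma homDim_zero_of_vertex {Δ : Finset (Finset ℕ)} {v : ℕ} (hv : {v} ∈ Δ) :
    homDim K Δ 0 = 0 := by
  refine homDim_eq_zero_of_le (inf_le_left.trans (Submodule.span_le.2 ?_))
  rintro _ ⟨F, hF, rfl⟩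
  obtain rfl : F = ∅ := by simpa [facesOf] using (Finset.mem_filter.1 hF).2
  have hmem := single_mem_chains (K := K) hv
  rw [Finset.card_singleton] at hmem
  exact Submodule.mem_map.2 ⟨_, hmem, bdry_vertex v⟩

lemma single_sub_single_mem_of_connected {Δ : Finset (Finset ℕ)} {a b : ℕ}
    (h : Relation.ReflTransGen (fun a b : ℕ => a ≠ b ∧ ({a, b} : Finset ℕ) ∈ Δ) a b) :
    Finsupp.single {b} (1 : K) - Finsupp.single {a} 1 ∈ (chains K Δ 2).map (bdry K) := by
  induction h with
  | refl => simp
  | @tail c d _ hcd ih =>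
    have key : Finsupp.single {d} (1 : K) - Finsupp.single {c} 1 ∈
        (chains K Δ 2).map (bdry K) := by
      have hmem := single_mem_chains (K := K) hcd.2
      rw [Finset.card_pair hcd.1] at hmem
      rcases lt_or_gt_of_ne hcd.1 with hlt | hlt
      · exact ⟨_, hmem, bdry_edge hlt⟩
      · refine ⟨-Finsupp.single {c, d} 1, Submodule.neg_mem _ hmem, ?_⟩
        rw [map_neg, Finset.pair_comm, bdry_edge hlt, neg_sub]
    simpa using Submodule.add_mem _ key ih

lemma homDim_one_of_connected {Δ : Finset (Finset ℕ)} (hΔ : IsConnectedComplex Δ) :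
    homDim K Δ 1 = 0 := by
  apply homDim_eq_zero_of_le
  rintro z ⟨hz, hker⟩
  by_cases hne : ∃ v, {v} ∈ Δ
  swap
  · have h0 : facesOf Δ 1 = ∅ := Finset.filter_eq_empty_iff.2 fun F hF hc => by
      obtain ⟨v, rfl⟩ := Finset.card_eq_one.1 hc
      exact hne ⟨v, hF⟩
    have : z = 0 := by simpa [chains, h0] using hz
    rw [this]; exact Submodule.zero_mem _
  obtain ⟨v, hv⟩ := hne
  have key : ∀ z ∈ chains K Δ 1, ∃ c : K, bdry K z = Finsupp.single ∅ c ∧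
      z - Finsupp.single {v} c ∈ (chains K Δ 2).map (bdry K) := by
    intro z hz
    induction hz using Submodule.span_induction with
    | mem x hx =>
      obtain ⟨F, hF, rfl⟩ := hx
      obtain ⟨hF, hc⟩ := Finset.mem_filter.1 hF
      obtain ⟨u, rfl⟩ := Finset.card_eq_one.1 hc
      exact ⟨1, bdry_vertex u, single_sub_single_mem_of_connected (hΔ v u hv hF)⟩
    | zero => exact ⟨0, by simp, by simp⟩
    | add x y _ _ hx hy =>
      obtain ⟨c, hc, hc'⟩ := hx
      obtain ⟨d, hd, hd'⟩ := hy
      refine ⟨c + d, by rw [map_add, hc, hd, Finsupp.single_add], ?_⟩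
      rw [Finsupp.single_add, add_sub_add_comm]
      exact Submodule.add_mem _ hc' hd'
    | smul a x _ hx =>
      obtain ⟨c, hc, hc'⟩ := hx
      refine ⟨a * c, by rw [map_smul, hc, Finsupp.smul_single, smul_eq_mul], ?_⟩
      rw [← smul_eq_mul, ← Finsupp.smul_single, ← smul_sub]
      exact Submodule.smul_mem _ a hc'
  obtain ⟨c, hc, hc'⟩ := key z hz
  have : c = 0 := by
    rw [LinearMap.mem_ker.1 hker] at hc
    simpa using hc.symm
  simpa [this] using hc'

lemma mem_link {Δ : Finset (Finset ℕ)} {F G : Finset ℕ} :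
    G ∈ link Δ F ↔ G ∈ Δ ∧ Disjoint G F ∧ G ∪ F ∈ Δ :=
  Finset.mem_filter

/-- A pure connected graph is Cohen–Macaulay. -/
lemma isCohenMacaulay_of_connected_graph {Λ : Finset (Finset ℕ)}
    (hdown : ∀ F ∈ Λ, ∀ G ⊆ F, G ∈ Λ) (hempty : ∅ ∈ Λ)
    (hpure : ∀ F ∈ Λ, ∃ E ∈ Λ, F ⊆ E ∧ E.card = 2)
    (hcard : ∀ F ∈ Λ, F.card ≤ 2) (hconn : IsConnectedComplex Λ) : IsCohenMacaulay K Λ := by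
  have hsup : Λ.sup Finset.card = 2 := by
    obtain ⟨E, hE, -, hc⟩ := hpure ∅ hempty
    exact le_antisymm (Finset.sup_le hcard) (hc ▸ Finset.le_sup (f := Finset.card) hE)
  intro F hF i hi
  simp only [dimZ, hsup] at hi
  unfold betti
  split_ifs with h0
  swap
  · rfl
  have hle : ∀ G ∈ link Λ F, G.card + F.card ≤ 2 := fun G hG => by
    rw [← Finset.card_union_of_disjoint (mem_link.1 hG).2.1]
    exact hcard _ (mem_link.1 hG).2.2
  obtain ⟨m, hm⟩ := Int.eq_ofNat_of_zero_le h0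
  rw [hm, Int.toNat_natCast]
  rcases lt_trichotomy (m + F.card) 2 with h | h | h
  · rcases Nat.eq_zero_or_pos m with rfl | hm0
    · obtain ⟨E, hE, hFE, hc⟩ := hpure F hF
      obtain ⟨v, hvE, hvF⟩ : ∃ v ∈ E, v ∉ F := Finset.exists_mem_notMem_of_card_lt_card (by omega)
      refine homDim_zero_of_vertex (v := v) (mem_link.2 ⟨?_, by simpa using hvF, ?_⟩)
      · exact hdown E hE _ (by simpa using hvE)
      · exact hdown E hE _ (Finset.union_subset (by simpa using hvE) hFE)
    · obtain rfl : m = 1 := by omega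
      obtain rfl : F = ∅ := Finset.card_eq_zero.1 (by omega)
      have : link Λ ∅ = Λ := by ext G; simp [mem_link]
      rw [this]
      exact homDim_one_of_connected hconn
  · push_cast at hi
    omega
  · exact homDim_eq_zero_of_card_ne fun G hG => by have := hle G hG; omega

/-- A pure two-dimensional complex with connected vertex links is Buchsbaum. -/
lemma isBuchsbaum_of_connected_links {Δ : Finset (Finset ℕ)}
    (hdown : ∀ F ∈ Δ, ∀ G ⊆ F, G ∈ Δ)
    (hpure : ∀ F ∈ Δ, ∃ T ∈ Δ, F ⊆ T ∧ T.card = 3)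
    (hcard : ∀ F ∈ Δ, F.card ≤ 3)
    (hconn : ∀ v : ℕ, ({v} : Finset ℕ) ∈ Δ → IsConnectedComplex (link Δ {v})) :
    IsBuchsbaum K Δ := by
  constructor
  · intro F hF hmax
    obtain ⟨T, hT, hFT, hc⟩ := hpure F hF
    rw [hmax T hT hFT, hc]
    exact le_antisymm (hc ▸ Finset.le_sup (f := Finset.card) hT) (Finset.sup_le hcard)
  · intro v hv
    refine isCohenMacaulay_of_connected_graph ?_ ?_ ?_ ?_ (hconn v hv)
    · intro F hF G hGF
      obtain ⟨h1, h2, h3⟩ := mem_link.1 hF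
      exact mem_link.2 ⟨hdown F h1 G hGF, Finset.disjoint_of_subset_left hGF h2,
        hdown _ h3 _ (Finset.union_subset_union_left hGF)⟩
    · exact mem_link.2 ⟨hdown _ hv _ (by simp), by simp, by simpa using hv⟩
    · intro F hF
      obtain ⟨h1, h2, h3⟩ := mem_link.1 hF
      obtain ⟨T, hT, hFT, hc⟩ := hpure _ h3
      have hvT : v ∈ T := hFT (by simp)
      refine ⟨T.erase v, mem_link.2 ⟨hdown T hT _ (Finset.erase_subset _ _), by simp, ?_⟩, ?_, ?_⟩
      · exact hdown T hT _ (Finset.union_subset (Finset.erase_subset _ _) (by simpa using hvT))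
      · exact Finset.subset_erase.2
          ⟨Finset.subset_union_left.trans hFT, by simpa using h2⟩
      · rw [Finset.card_erase_of_mem hvT, hc]
    · intro F hF
      obtain ⟨-, h2, h3⟩ := mem_link.1 hF
      have := hcard _ h3
      rw [Finset.card_union_of_disjoint h2, Finset.card_singleton] at this
      omega

end Homology

section Faces

/-- `r ∈ [n]` represents the residue class of `i ∈ {1,…,2n}` modulo `n`. -/
def IsRep (n i r : ℕ) : Prop := 1 ≤ r ∧ r ≤ n ∧ (i = r ∨ i = r + n)

lemma exists_rep {n i : ℕ} (h1 : 1 ≤ i) (h2 : i ≤ 2 * n) : ∃ r, IsRep n i r := by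
  unfold IsRep
  rcases le_or_gt i n with h | h
  · exact ⟨i, by omega⟩
  · exact ⟨i - n, by omega⟩

lemma modRep_eq {n i r : ℕ} {a : ℤ} (h : IsRep n i r) (ha : a = i) : modRep n a = r := by
  obtain ⟨h1, h2, h3⟩ := h
  unfold modRep
  have : (a - 1) % (n : ℤ) = r - 1 := by
    rcases h3 with h3 | h3
    · rw [show a - 1 = (r : ℤ) - 1 by omega]
      exact Int.emod_eq_of_lt (by omega) (by omega)
    · rw [show a - 1 = ((r : ℤ) - 1) + n by omega, Int.add_emod_right]
      exact Int.emod_eq_of_lt (by omega) (by omega)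
  omega

/-- The sorted triangles `x < y < z` of the complex `Δ_k`. -/
def IsTri (p b k x y z : ℕ) : Prop :=
  1 ≤ x ∧ x < y ∧ y < z ∧ z < 3 * p ∧
  ((y = x + 1 ∧ z % 3 = (x + 2) % 3 ∧ ¬ (x = 1 ∧ 6 ≤ z ∧ z ≤ 3 * b + 3)) ∨
   (z = y + 1 ∧ x % 3 = y % 3 ∧ ¬ (x = 2 ∧ y ≤ 3 * b + 2)) ∨
   (x = 1 ∧ z + 1 = 3 * p ∧ y % 3 = 2) ∨
   (x = 1 ∧ z = y + 1 ∧ y % 3 = 2 ∧ 3 * b + 5 ≤ y ∧ y ≤ 3 * (b + k) + 2))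

/-- The sorted edges `x < y` of the complex `Δ_k`. -/
def IsEdge (p b x y : ℕ) : Prop :=
  1 ≤ x ∧ x < y ∧ y < 3 * p ∧ ¬ (x = 1 ∧ y % 3 = 0 ∧ 6 ≤ y ∧ y ≤ 3 * b + 3) ∧
    ¬ (x = 2 ∧ y % 3 ≠ 1 ∧ 5 ≤ y ∧ y ≤ 3 * b + 3)

/-- The triangle `{ī, (i+1)¯, (i+2+3j)¯}` is not one of those of `Δ(1,1),…,Δ(1,b)`. -/
def Kept (p b i j : ℕ) : Prop :=
  ¬ (i = 1 ∧ 1 ≤ j ∧ j ≤ b) ∧ ¬ (i + 3 * j + 1 = 3 * p ∧ p ≤ j + b + 1)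

lemma DeltaA_eq {p i j v w t : ℕ} (hi : 1 ≤ i) (hin : i < 3 * p)
    (hv : IsRep (3 * p - 1) (i + 1) v) (hw : IsRep (3 * p - 1) (i + 2 + 3 * j) w)
    (ht : IsRep (3 * p - 1) (i + 1 + 3 * j) t) :
    DeltaA p i j = ({i, v, w} : Finset ℕ).powerset ∪ ({t, w, v} : Finset ℕ).powerset := by
  have hi' : IsRep (3 * p - 1) i i := by unfold IsRep; omega
  unfold DeltaA
  rw [modRep_eq hi' rfl, modRep_eq hv (by push_cast; rfl), modRep_eq hw (by push_cast; rfl),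
    modRep_eq ht (by push_cast; rfl)]

lemma DeltaA_ne_iff {p b i j : ℕ} (hb : b ≤ p - 2) (hi : 1 ≤ i) (hin : i < 3 * p)
    (hj : 1 ≤ j) (hjp : j ≤ p - 2) :
    (∀ j' ∈ Finset.Icc 1 b, DeltaA p i j ≠ DeltaA p 1 j') ↔ Kept p b i j := by
  obtain ⟨v, hv⟩ := exists_rep (n := 3 * p - 1) (i := i + 1) (by omega) (by omega)
  obtain ⟨w, hw⟩ := exists_rep (n := 3 * p - 1) (i := i + 2 + 3 * j) (by omega) (by omega)
  obtain ⟨t, ht⟩ := exists_rep (n := 3 * p - 1) (i := i + 1 + 3 * j) (by omega) (by omega)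
  have hone : ∀ j', 1 ≤ j' → j' ≤ p - 2 → DeltaA p 1 j' =
      ({1, 2, 3 + 3 * j'} : Finset ℕ).powerset ∪
        ({2 + 3 * j', 3 + 3 * j', 2} : Finset ℕ).powerset := fun j' h1 h2 =>
    DeltaA_eq le_rfl (by omega) (by unfold IsRep; omega) (by unfold IsRep; omega)
      (by unfold IsRep; omega)
  constructor
  · intro h
    constructor
    · rintro ⟨rfl, -, hjb⟩
      exact h j (by simp; omega) rfl
    · rintro ⟨h1, h2⟩
      apply h (p - 1 - j) (by simp; omega)
      rw [DeltaA_eq hi hin hv hw ht, hone _ (by omega) (by omega), Finset.union_comm]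
      unfold IsRep at hv hw ht
      congr 2 <;> ext a <;> simp only [Finset.mem_insert, Finset.mem_singleton] <;> omega
  · rintro ⟨hk1, hk2⟩ j' hj' heq
    rw [Finset.mem_Icc] at hj'
    rw [DeltaA_eq hi hin hv hw ht, hone _ (by omega) (by omega)] at heq
    have hmem : ({i, v, w} : Finset ℕ) ∈ ({1, 2, 3 + 3 * j'} : Finset ℕ).powerset ∪
        ({2 + 3 * j', 3 + 3 * j', 2} : Finset ℕ).powerset := by
      rw [← heq]; simp
    unfold IsRep at hv hw ht
    simp only [Finset.mem_union, Finset.mem_powerset, Finset.insert_subset_iff,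
      Finset.singleton_subset_iff, Finset.mem_insert, Finset.mem_singleton] at hmem
    omega

lemma mem_GammaA {p b : ℕ} (hp : 2 ≤ p) (hb : b ≤ p - 2) {F : Finset ℕ} :
    F ∈ GammaA p b ↔ ∃ i j v w, 1 ≤ i ∧ i < 3 * p ∧ j + 2 ≤ p ∧ IsRep (3 * p - 1) (i + 1) v ∧
      IsRep (3 * p - 1) (i + 2 + 3 * j) w ∧ Kept p b i j ∧ F ⊆ {i, v, w} := by
  unfold GammaA SigmaA
  simp only [Finset.mem_union, Finset.mem_biUnion, Finset.mem_filter, Finset.mem_product]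
  constructor
  · rintro (⟨i, hi, hF⟩ | ⟨⟨i, j⟩, ⟨⟨hi, hj⟩, hne⟩, hF⟩)
    · rw [Finset.mem_Icc] at hi
      obtain ⟨v, hv⟩ := exists_rep (n := 3 * p - 1) (i := i + 1) (by omega) (by omega)
      obtain ⟨w, hw⟩ := exists_rep (n := 3 * p - 1) (i := i + 2) (by omega) (by omega)
      have hi' : IsRep (3 * p - 1) i i := by unfold IsRep; omega
      rw [modRep_eq hi' rfl, modRep_eq hv (by push_cast; rfl), modRep_eq hw (by push_cast; rfl),
        Finset.mem_powerset] at hF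
      refine ⟨i, 0, v, w, by omega, by omega, ?_, hv, hw, by unfold Kept; omega, hF⟩
      omega
    · simp only [Finset.mem_Icc] at hi hj
      rw [DeltaA_ne_iff hb hi.1 (by omega) hj.1 hj.2] at hne
      obtain ⟨v, hv⟩ := exists_rep (n := 3 * p - 1) (i := i + 1) (by omega) (by omega)
      obtain ⟨w, hw⟩ := exists_rep (n := 3 * p - 1) (i := i + 2 + 3 * j) (by omega) (by omega)
      obtain ⟨t, ht⟩ := exists_rep (n := 3 * p - 1) (i := i + 1 + 3 * j) (by omega) (by omega)
      rw [DeltaA_eq hi.1 (by omega) hv hw ht, Finset.mem_union, Finset.mem_powerset,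
        Finset.mem_powerset] at hF
      rcases hF with hF | hF
      · exact ⟨i, j, v, w, hi.1, by omega, by omega, hv, hw, hne, hF⟩
      · unfold IsRep at hv hw ht
        unfold Kept at hne
        refine ⟨t, p - 1 - j, w, v, by omega, by omega, by omega, by unfold IsRep; omega,
          by unfold IsRep; omega, by unfold Kept; omega, hF⟩
  · rintro ⟨i, j, v, w, hi, hin, hj, hv, hw, hk, hF⟩
    rcases Nat.eq_zero_or_pos j with rfl | hj0
    · left
      have hi' : IsRep (3 * p - 1) i i := by unfold IsRep; omega
      refine ⟨i, by simp; omega, ?_⟩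
      rw [modRep_eq hi' rfl, modRep_eq hv (by push_cast; rfl), modRep_eq hw (by simp)]
      simpa using hF
    · right
      obtain ⟨t, ht⟩ := exists_rep (n := 3 * p - 1) (i := i + 1 + 3 * j) (by omega) (by omega)
      refine ⟨(i, j), ⟨by simp; omega, (DeltaA_ne_iff hb hi hin hj0 (by omega)).2 hk⟩, ?_⟩
      rw [DeltaA_eq hi hin hv hw ht]
      exact Finset.mem_union_left _ (Finset.mem_powerset.2 hF)

lemma mem_DeltaAk {p b k : ℕ} (hp : 2 ≤ p) (hbk : b + k ≤ p - 2) {F : Finset ℕ} :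
    F ∈ DeltaAk p b k ↔ ∃ x y z, IsTri p b k x y z ∧ F ⊆ {x, y, z} := by
  unfold DeltaAk
  simp only [Finset.mem_union, mem_GammaA hp (show b ≤ p - 2 by omega), Finset.mem_biUnion,
    Finset.mem_powerset, GA]
  constructor
  · rintro (⟨i, j, v, w, hi, hin, hj, hv, hw, hk, hF⟩ | ⟨j, hj, hF⟩)
    · have hsub : ∀ x y z : ℕ, (∀ a, a = i ∨ a = v ∨ a = w → a = x ∨ a = y ∨ a = z) →
          F ⊆ {x, y, z} := fun x y z h a ha => by
        simpa using h a (by simpa using hF ha)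
      unfold IsRep at hv hw
      unfold Kept at hk
      unfold IsTri
      obtain ⟨hv1, hv2, hv⟩ := hv
      obtain ⟨hw1, hw2, hw⟩ := hw
      rcases hv with hv | hv
      · rcases hw with hw | hw
        · exact ⟨i, v, w, ⟨hi, by omega, by omega, by omega,
            Or.inl ⟨by omega, by omega, by omega⟩⟩, hsub _ _ _ (by omega)⟩
        · exact ⟨w, i, v, ⟨hw1, by omega, by omega, by omega,
            Or.inr (Or.inl ⟨by omega, by omega, by omega⟩)⟩, hsub _ _ _ (by omega)⟩
      · exact ⟨v, w, i, ⟨hv1, by omega, by omega, by omega,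
          Or.inr (Or.inr (Or.inl ⟨by omega, by omega, by omega⟩))⟩, hsub _ _ _ (by omega)⟩
    · rw [Finset.mem_Icc] at hj
      exact ⟨_, _, _, by unfold IsTri; omega, hF⟩
  · rintro ⟨x, y, z, ⟨h1, h2, h3, h4, h⟩, hF⟩
    have hsub : ∀ i v w : ℕ, (∀ a, a = x ∨ a = y ∨ a = z → a = i ∨ a = v ∨ a = w) →
        F ⊆ {i, v, w} := fun x y z h a ha => by
      simpa using h a (by simpa using hF ha)
    unfold IsRep Kept
    rcases h with h | h | h | h
    · exact Or.inl ⟨x, (z - x - 2) / 3, y, z, by omega, by omega, by omega, by omega, by omega,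
        by omega, hF⟩
    · exact Or.inl ⟨y, p - 1 - (y - x) / 3, z, x, by omega, by omega, by omega, by omega, by omega,
        by omega, hsub _ _ _ (by omega)⟩
    · exact Or.inl ⟨z, (y - 2) / 3, x, y, by omega, by omega, by omega, by omega, by omega,
        by omega, hsub _ _ _ (by omega)⟩
    · exact Or.inr ⟨(y - 2) / 3, by simp; omega, hsub _ _ _ (by omega)⟩

lemma edge_mem_iff {p b k x y : ℕ} (hp : 2 ≤ p) (hbk : b + k ≤ p - 2) (hxy : x < y) :
    ({x, y} : Finset ℕ) ∈ DeltaAk p b k ↔ IsEdge p b x y := by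
  simp only [mem_DeltaAk hp hbk, Finset.insert_subset_iff, Finset.singleton_subset_iff,
    Finset.mem_insert, Finset.mem_singleton]
  unfold IsTri IsEdge
  constructor
  · rintro ⟨x', y', z', h, h1, h2⟩
    omega
  · intro h
    have hz : (y - x) % 3 = 0 ∨ (y - x) % 3 = 1 ∨ (y - x) % 3 = 2 := by omega
    rcases hz with hz | hz | hz
    · rcases eq_or_ne (y + 1) (3 * p) with hy | hy
      · exact ⟨1, x, y, by omega⟩
      · exact ⟨x, y, y + 1, by omega⟩
    · rcases eq_or_ne x 1 with rfl | hx
      · rcases eq_or_ne y 2 with rfl | hy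
        · exact ⟨1, 2, 3, by omega⟩
        · rcases eq_or_ne (y + 1) (3 * p) with hy | hy
          · exact ⟨1, 2, y, by omega⟩
          · exact ⟨1, y, 3 * p - 1, by omega⟩
      · exact ⟨x - 1, x, y, by omega⟩
    · exact ⟨x, x + 1, y, by omega⟩

lemma vertex_mem_iff {p b k v : ℕ} (hp : 2 ≤ p) (hbk : b + k ≤ p - 2) :
    ({v} : Finset ℕ) ∈ DeltaAk p b k ↔ 1 ≤ v ∧ v < 3 * p := by
  simp only [mem_DeltaAk hp hbk, Finset.singleton_subset_iff, Finset.mem_insert,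
    Finset.mem_singleton]
  unfold IsTri
  constructor
  · rintro ⟨x', y', z', h, h1⟩
    omega
  · intro h
    rcases eq_or_ne v 1 with rfl | h1
    · exact ⟨1, 2, 3, by omega⟩
    · rcases eq_or_ne (v + 1) (3 * p) with h2 | h2
      · exact ⟨1, 2, v, by omega⟩
      · exact ⟨v - 1, v, v + 1, by omega⟩

lemma DeltaAk_down {p b k : ℕ} (hp : 2 ≤ p) (hbk : b + k ≤ p - 2) :
    ∀ F ∈ DeltaAk p b k, ∀ G ⊆ F, G ∈ DeltaAk p b k := by
  intro F hF G hG
  rw [mem_DeltaAk hp hbk] at hF ⊢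
  obtain ⟨x, y, z, h, hs⟩ := hF
  exact ⟨x, y, z, h, hG.trans hs⟩

lemma card_triple {x y z : ℕ} (hxy : x < y) (hyz : y < z) : ({x, y, z} : Finset ℕ).card = 3 := by
  rw [Finset.card_eq_three]
  exact ⟨x, y, z, by omega, by omega, by omega, rfl⟩

end Faces

section Connectivity

lemma isTri_low {p b k x y z : ℕ} (hx : 1 ≤ x) (hy : y = x + 1) (hyz : y < z) (hz : z < 3 * p)
    (hmod : z % 3 = (x + 2) % 3) (h : ¬ (x = 1 ∧ 6 ≤ z ∧ z ≤ 3 * b + 3)) : IsTri p b k x y z :=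
  ⟨hx, by omega, hyz, hz, Or.inl ⟨hy, hmod, h⟩⟩

lemma isTri_high {p b k x y z : ℕ} (hx : 1 ≤ x) (hxy : x < y) (hz : z = y + 1) (hzp : z < 3 * p)
    (hmod : x % 3 = y % 3) (h : ¬ (x = 2 ∧ y ≤ 3 * b + 2)) : IsTri p b k x y z :=
  ⟨hx, hxy, by omega, hzp, Or.inr (Or.inl ⟨hz, hmod, h⟩)⟩

lemma isTri_wrap {p b k x y z : ℕ} (hx : x = 1) (hxy : x < y) (hyz : y < z) (hz : z + 1 = 3 * p)
    (hmod : y % 3 = 2) : IsTri p b k x y z :=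
  ⟨by omega, hxy, hyz, by omega, Or.inr (Or.inr (Or.inl ⟨hx, hz, hmod⟩))⟩

lemma ne_and_mem_link_of_isTri {p b k u w v x y z : ℕ} (hp : 2 ≤ p) (hbk : b + k ≤ p - 2)
    (h : IsTri p b k x y z) (huw : u ≠ w) (huv : u ≠ v) (hwv : w ≠ v)
    (hu : u = x ∨ u = y ∨ u = z) (hw : w = x ∨ w = y ∨ w = z) (hv : v = x ∨ v = y ∨ v = z) :
    u ≠ w ∧ ({u, w} : Finset ℕ) ∈ link (DeltaAk p b k) {v} := by
  refine ⟨huw, mem_link.2 ⟨?_, by simp; omega, ?_⟩⟩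
  · exact (mem_DeltaAk hp hbk).2 ⟨x, y, z, h, by
      simp only [Finset.insert_subset_iff, Finset.singleton_subset_iff, Finset.mem_insert,
        Finset.mem_singleton]; omega⟩
  · exact (mem_DeltaAk hp hbk).2 ⟨x, y, z, h, by
      simp only [Finset.union_subset_iff, Finset.insert_subset_iff, Finset.singleton_subset_iff,
        Finset.mem_insert, Finset.mem_singleton]; omega⟩

lemma reflTransGen_symm {r : ℕ → ℕ → Prop} (hr : ∀ a c, r a c → r c a) {a c : ℕ}
    (h : Relation.ReflTransGen r a c) : Relation.ReflTransGen r c a :=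
  Relation.ReflTransGen.mono (fun _ _ h => hr _ _ h) _ _ (Relation.ReflTransGen.swap _ _ h)

/-- Adjacency in the link of `v`. -/
def LinkAdj (p b k v a c : ℕ) : Prop :=
  a ≠ c ∧ ({a, c} : Finset ℕ) ∈ link (DeltaAk p b k) {v}

lemma link_step {p b k u w v x y z : ℕ} (hp : 2 ≤ p) (hbk : b + k ≤ p - 2)
    (h : IsTri p b k x y z) (huw : u ≠ w) (huv : u ≠ v) (hwv : w ≠ v)
    (hu : u = x ∨ u = y ∨ u = z) (hw : w = x ∨ w = y ∨ w = z) (hv : v = x ∨ v = y ∨ v = z) :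
    Relation.ReflTransGen (LinkAdj p b k v) u w :=
  .single (ne_and_mem_link_of_isTri hp hbk h huw huv hwv hu hw hv)

lemma link_path_succ {p b k s v r : ℕ} (hp : 2 ≤ p) (hbk : b + k ≤ p - 2)
    (hv : 1 ≤ v) (hvn : v < 3 * p) (hr : IsRep (3 * p - 1) (v + (3 * p - 2)) r)
    (hs : IsRep (3 * p - 1) (v + 1) s) : Relation.ReflTransGen (LinkAdj p b k v) s r := by
  obtain ⟨hr1, hr2, hr⟩ := hr
  obtain ⟨hs1, hs2, hs⟩ := hs
  rcases eq_or_ne v 1 with h1 | h1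
  · exact link_step hp hbk (x := 1) (y := 2) (z := r)
      (isTri_wrap (by omega) (by omega) (by omega) (by omega) (by omega))
      (by omega) (by omega) (by omega) (by omega) (by omega) (by omega)
  · rcases eq_or_ne (v + 1) (3 * p) with h2 | h2
    · exact link_step hp hbk (x := 1) (y := r) (z := v)
        (isTri_high (by omega) (by omega) (by omega) (by omega) (by omega) (by omega))
        (by omega) (by omega) (by omega) (by omega) (by omega) (by omega)
    · exact link_step hp hbk (x := r) (y := v) (z := s)
        (isTri_low (by omega) (by omega) (by omega) (by omega) (by omega) (by omega))
        (by omega) (by omega) (by omega) (by omega) (by omega) (by omega)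

lemma link_path_above {p b k u v r : ℕ} (hp : 2 ≤ p) (hbk : b + k ≤ p - 2)
    (hr : IsRep (3 * p - 1) (v + (3 * p - 2)) r)
    (hlt : v < u) (hE : IsEdge p b v u) (hmod : u % 3 = (v + 1) % 3) :
    Relation.ReflTransGen (LinkAdj p b k v) u r := by
  unfold IsEdge at hE
  rcases eq_or_ne u (v + 1) with h1 | h1
  · exact link_path_succ hp hbk (by omega) (by omega) hr (by unfold IsRep; omega)
  · obtain ⟨hr1, hr2, hr⟩ := hr
    rcases eq_or_ne v 1 with h2 | h2
    · rcases eq_or_ne u r with rfl | h3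
      · exact .refl
      · exact link_step hp hbk (x := 1) (y := u) (z := r)
          (isTri_wrap (by omega) (by omega) (by omega) (by omega) (by omega))
          (by omega) (by omega) (by omega) (by omega) (by omega) (by omega)
    · exact link_step hp hbk (x := r) (y := v) (z := u)
        (isTri_low (by omega) (by omega) (by omega) (by omega) (by omega) (by omega))
        (by omega) (by omega) (by omega) (by omega) (by omega) (by omega)

lemma link_path_below {p b k u v r : ℕ} (hp : 2 ≤ p) (hbk : b + k ≤ p - 2)
    (hr : IsRep (3 * p - 1) (v + (3 * p - 2)) r)
    (hlt : u < v) (hE : IsEdge p b u v) (hmod : v % 3 = (u + 1) % 3) :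
    Relation.ReflTransGen (LinkAdj p b k v) u r := by
  unfold IsEdge at hE
  obtain ⟨hr1, hr2, hr⟩ := hr
  rcases eq_or_ne u r with rfl | h1
  · exact .refl
  · exact link_step hp hbk (x := u) (y := r) (z := v)
      (isTri_high (by omega) (by omega) (by omega) (by omega) (by omega) (by omega))
      (by omega) (by omega) (by omega) (by omega) (by omega) (by omega)

/-- In the link of `v`, every vertex is joined by a path to the cyclic predecessor `r` of `v`. -/
lemma link_path_to_pred {p b k u v r : ℕ} (hp : 2 ≤ p) (hbk : b + k ≤ p - 2)
    (hr : IsRep (3 * p - 1) (v + (3 * p - 2)) r)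
    (huv : u ≠ v) (hE : ({u, v} : Finset ℕ) ∈ DeltaAk p b k) :
    Relation.ReflTransGen (LinkAdj p b k v) u r := by
  rcases lt_or_gt_of_ne huv with hlt | hlt
  · rw [edge_mem_iff hp hbk hlt] at hE
    have hmod : v % 3 = (u + 1) % 3 ∨ v % 3 = u % 3 ∨ v % 3 = (u + 2) % 3 := by omega
    rcases hmod with hmod | hmod | hmod
    · exact link_path_below hp hbk hr hlt hE hmod
    · unfold IsEdge at hE
      rcases eq_or_ne (v + 1) (3 * p) with h | h
      · exact (link_step hp hbk (w := 1) (x := 1) (y := u) (z := v)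
          (isTri_wrap (by omega) (by omega) (by omega) (by omega) (by omega))
          (by omega) (by omega) (by omega) (by omega) (by omega) (by omega)).trans
          (link_path_succ hp hbk (by omega) (by omega) hr (by unfold IsRep; omega))
      · exact (link_step hp hbk (w := v + 1) (x := u) (y := v) (z := v + 1)
          (isTri_high (by omega) (by omega) (by omega) (by omega) (by omega) (by omega))
          (by omega) (by omega) (by omega) (by omega) (by omega) (by omega)).trans
          (link_path_succ hp hbk (by omega) (by omega) hr (by unfold IsRep; omega))
    · unfold IsEdge at hE
      exact (link_step hp hbk (w := u + 1) (x := u) (y := u + 1) (z := v)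
        (isTri_low (by omega) (by omega) (by omega) (by omega) (by omega) (by omega))
        (by omega) (by omega) (by omega) (by omega) (by omega) (by omega)).trans
        (link_path_below hp hbk hr (by omega) (by unfold IsEdge; omega) (by omega))
  · rw [Finset.pair_comm, edge_mem_iff hp hbk hlt] at hE
    have hmod : u % 3 = (v + 1) % 3 ∨ u % 3 = v % 3 ∨ u % 3 = (v + 2) % 3 := by omega
    rcases hmod with hmod | hmod | hmod
    · exact link_path_above hp hbk hr hlt hE hmod
    · unfold IsEdge at hE
      rcases eq_or_ne (u + 1) (3 * p) with h | h
      · exact (link_step hp hbk (w := 1) (x := 1) (y := v) (z := u)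
          (isTri_wrap (by omega) (by omega) (by omega) (by omega) (by omega))
          (by omega) (by omega) (by omega) (by omega) (by omega) (by omega)).trans
          (link_path_below hp hbk hr (by omega) (by unfold IsEdge; omega) (by omega))
      · exact (link_step hp hbk (w := u + 1) (x := v) (y := u) (z := u + 1)
          (isTri_high (by omega) (by omega) (by omega) (by omega) (by omega) (by omega))
          (by omega) (by omega) (by omega) (by omega) (by omega) (by omega)).trans
          (link_path_above hp hbk hr (by omega) (by unfold IsEdge; omega) (by omega))
    · unfold IsEdge at hE
      exact (link_step hp hbk (w := v + 1) (x := v) (y := v + 1) (z := u)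
        (isTri_low (by omega) (by omega) (by omega) (by omega) (by omega) (by omega))
        (by omega) (by omega) (by omega) (by omega) (by omega) (by omega)).trans
        (link_path_succ hp hbk (by omega) (by omega) hr (by unfold IsRep; omega))

lemma link_connected {p b k v : ℕ} (hp : 2 ≤ p) (hbk : b + k ≤ p - 2)
    (hv : ({v} : Finset ℕ) ∈ DeltaAk p b k) : IsConnectedComplex (link (DeltaAk p b k) {v}) := by
  obtain ⟨h1, h2⟩ := (vertex_mem_iff hp hbk).1 hv
  obtain ⟨r, hr⟩ := exists_rep (n := 3 * p - 1) (i := v + (3 * p - 2)) (by omega) (by omega)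
  have path : ∀ u, {u} ∈ link (DeltaAk p b k) {v} → Relation.ReflTransGen (LinkAdj p b k v) u r := by
    intro u hu
    obtain ⟨-, hd, hE⟩ := mem_link.1 hu
    exact link_path_to_pred hp hbk hr (by simpa using hd) hE
  intro u w hu hw
  refine (path u hu).trans (reflTransGen_symm ?_ (path w hw))
  rintro a c ⟨hac, hmem⟩
  exact ⟨hac.symm, by rwa [Finset.pair_comm]⟩

lemma DeltaAk_connected {p b k : ℕ} (hp : 2 ≤ p) (hbk : b + k ≤ p - 2) :
    IsConnectedComplex (DeltaAk p b k) := by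
  have path : ∀ v, v + 1 < 3 * p → Relation.ReflTransGen
      (fun a c : ℕ => a ≠ c ∧ ({a, c} : Finset ℕ) ∈ DeltaAk p b k) 1 (v + 1) := by
    intro v hv
    induction v with
    | zero => exact .refl
    | succ v ih =>
      refine (ih (by omega)).tail ⟨by omega, ?_⟩
      rw [edge_mem_iff hp hbk (by omega)]
      unfold IsEdge
      omega
  intro u w hu hw
  rw [vertex_mem_iff hp hbk] at hu hw
  obtain ⟨u, rfl⟩ := Nat.exists_eq_add_of_le' hu.1
  obtain ⟨w, rfl⟩ := Nat.exists_eq_add_of_le' hw.1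
  refine (reflTransGen_symm ?_ (path u hu.2)).trans (path w hw.2)
  rintro a c ⟨hac, hmem⟩
  exact ⟨hac.symm, by rwa [Finset.pair_comm]⟩

lemma DeltaAk_isBuchsbaum (K : Type) [Field K] {p b k : ℕ} (hp : 2 ≤ p) (hbk : b + k ≤ p - 2) :
    IsBuchsbaum K (DeltaAk p b k) := by
  refine isBuchsbaum_of_connected_links (DeltaAk_down hp hbk) ?_ ?_
    fun v hv => link_connected hp hbk hv
  · intro F hF
    obtain ⟨x, y, z, h, hs⟩ := (mem_DeltaAk hp hbk).1 hF
    exact ⟨{x, y, z}, (mem_DeltaAk hp hbk).2 ⟨x, y, z, h, subset_rfl⟩, hs,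
      card_triple h.2.1 h.2.2.1⟩
  · intro F hF
    obtain ⟨x, y, z, -, hs⟩ := (mem_DeltaAk hp hbk).1 hF
    exact (Finset.card_le_card hs).trans Finset.card_le_three

end Connectivity

section Counting

lemma card_facesOf_one {p b k : ℕ} (hp : 2 ≤ p) (hbk : b + k ≤ p - 2) :
    (facesOf (DeltaAk p b k) 1).card = 3 * p - 1 := by
  have : facesOf (DeltaAk p b k) 1 = (Finset.Icc 1 (3 * p - 1)).image fun v => {v} := by
    ext F
    simp only [facesOf, Finset.mem_filter, Finset.mem_image, Finset.mem_Icc, Finset.card_eq_one]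
    constructor
    · rintro ⟨hF, v, rfl⟩
      rw [vertex_mem_iff hp hbk] at hF
      exact ⟨v, by omega, rfl⟩
    · rintro ⟨v, hv, rfl⟩
      exact ⟨(vertex_mem_iff hp hbk).2 (by omega), v, rfl⟩
  rw [this, Finset.card_image_of_injective _ Finset.singleton_injective, Nat.card_Icc]
  omega

lemma pair_eq_pair_of_lt {x y x' y' : ℕ} (h : x < y) (h' : x' < y')
    (he : ({x, y} : Finset ℕ) = {x', y'}) : x = x' ∧ y = y' := by
  have hs := he.subset
  simp only [Finset.insert_subset_iff, Finset.singleton_subset_iff, Finset.mem_insert,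
    Finset.mem_singleton] at hs
  omega

lemma triple_eq_triple_of_lt {x y z x' y' z' : ℕ} (hxy : x < y) (hyz : y < z) (hxy' : x' < y')
    (hyz' : y' < z') (he : ({x, y, z} : Finset ℕ) = {x', y', z'}) :
    x = x' ∧ y = y' ∧ z = z' := by
  have hs := he.subset
  simp only [Finset.insert_subset_iff, Finset.singleton_subset_iff, Finset.mem_insert,
    Finset.mem_singleton] at hs
  omega

lemma exists_lt_of_card_eq_two {F : Finset ℕ} (h : F.card = 2) :
    ∃ x y, x < y ∧ F = {x, y} := by
  obtain ⟨x, y, hxy, rfl⟩ := Finset.card_eq_two.1 h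
  rcases lt_or_gt_of_ne hxy with hlt | hlt
  · exact ⟨x, y, hlt, rfl⟩
  · exact ⟨y, x, hlt, Finset.pair_comm _ _⟩

/-- The edges that are missing from `Γ`. -/
def removedEdges (b : ℕ) : Finset (Finset ℕ) :=
  ((Finset.Icc 1 b).image fun j => {1, 3 + 3 * j}) ∪
    (((Finset.Icc 1 b).image fun j => {2, 3 + 3 * j}) ∪
      ((Finset.Icc 1 b).image fun j => {2, 2 + 3 * j}))

lemma pair_mem_removedEdges {b x y : ℕ} (h : x < y) : {x, y} ∈ removedEdges b ↔
    (x = 1 ∧ y % 3 = 0 ∧ 6 ≤ y ∧ y ≤ 3 * b + 3) ∨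
      (x = 2 ∧ y % 3 ≠ 1 ∧ 5 ≤ y ∧ y ≤ 3 * b + 3) := by
  simp only [removedEdges, Finset.mem_union, Finset.mem_image, Finset.mem_Icc]
  constructor
  · rintro (⟨j, hj, he⟩ | ⟨j, hj, he⟩ | ⟨j, hj, he⟩) <;>
      have := pair_eq_pair_of_lt (by omega) h he <;> omega
  · rintro (⟨rfl, h1⟩ | ⟨rfl, h1⟩)
    · exact Or.inl ⟨(y - 3) / 3, by omega, by congr 2; omega⟩
    · rcases Nat.eq_zero_or_pos (y % 3) with h2 | h2
      · exact Or.inr (Or.inl ⟨(y - 3) / 3, by omega, by congr 2; omega⟩)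
      · exact Or.inr (Or.inr ⟨(y - 2) / 3, by omega, by congr 2; omega⟩)

lemma card_removedEdges (b : ℕ) : (removedEdges b).card = 3 * b := by
  have hinj : ∀ a c : ℕ, a < c + 3 →
      ((Finset.Icc 1 b).image fun j => ({a, c + 3 * j} : Finset ℕ)).card = b := by
    intro a c hac
    rw [Finset.card_image_of_injOn, Nat.card_Icc, Nat.add_sub_cancel]
    intro i hi j hj he
    rw [Finset.coe_Icc, Set.mem_Icc] at hi hj
    have := pair_eq_pair_of_lt (by omega) (by omega) he
    omega
  have hdisj : ∀ a c a' c' : ℕ, a < c + 3 → a' < c' + 3 → a ≠ a' ∨ c % 3 ≠ c' % 3 →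
      Disjoint ((Finset.Icc 1 b).image fun j => ({a, c + 3 * j} : Finset ℕ))
        ((Finset.Icc 1 b).image fun j => ({a', c' + 3 * j} : Finset ℕ)) := by
    intro a c a' c' h h' hne
    rw [Finset.disjoint_left]
    intro F hF hF'
    simp only [Finset.mem_image, Finset.mem_Icc] at hF hF'
    obtain ⟨i, hi, rfl⟩ := hF
    obtain ⟨j, hj, he⟩ := hF'
    have := pair_eq_pair_of_lt (by omega) (by omega) he
    omega
  unfold removedEdges
  rw [Finset.card_union_of_disjoint, Finset.card_union_of_disjoint, hinj _ _ (by norm_num),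
    hinj _ _ (by norm_num), hinj _ _ (by norm_num)]
  · ring
  · exact hdisj _ _ _ _ (by norm_num) (by norm_num) (by norm_num)
  · rw [Finset.disjoint_union_right]
    exact ⟨hdisj _ _ _ _ (by norm_num) (by norm_num) (by norm_num),
      hdisj _ _ _ _ (by norm_num) (by norm_num) (by norm_num)⟩

lemma card_facesOf_two {p b k : ℕ} (hp : 2 ≤ p) (hbk : b + k ≤ p - 2) :
    (facesOf (DeltaAk p b k) 2).card + 3 * b = (3 * p - 1).choose 2 := by
  have hdisj : Disjoint (facesOf (DeltaAk p b k) 2) (removedEdges b) := by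
    rw [Finset.disjoint_left]
    intro F hF hR
    obtain ⟨hF, hc⟩ := Finset.mem_filter.1 hF
    obtain ⟨x, y, hxy, rfl⟩ := exists_lt_of_card_eq_two hc
    rw [edge_mem_iff hp hbk hxy] at hF
    rw [pair_mem_removedEdges hxy] at hR
    unfold IsEdge at hF
    omega
  have hunion : facesOf (DeltaAk p b k) 2 ∪ removedEdges b =
      (Finset.Icc 1 (3 * p - 1)).powersetCard 2 := by
    ext F
    rw [Finset.mem_union, Finset.mem_powersetCard, facesOf, Finset.mem_filter]
    constructor
    · intro h
      have hc : F.card = 2 := by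
        rcases h with h | h
        · exact h.2
        · simp only [removedEdges, Finset.mem_union, Finset.mem_image, Finset.mem_Icc] at h
          rcases h with ⟨j, hj, rfl⟩ | ⟨j, hj, rfl⟩ | ⟨j, hj, rfl⟩ <;>
            exact Finset.card_pair (by omega)
      refine ⟨?_, hc⟩
      obtain ⟨x, y, hxy, rfl⟩ := exists_lt_of_card_eq_two hc
      rw [edge_mem_iff hp hbk hxy, pair_mem_removedEdges hxy] at h
      unfold IsEdge at h
      simp only [Finset.insert_subset_iff, Finset.singleton_subset_iff, Finset.mem_Icc]
      omega
    · rintro ⟨hs, hc⟩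
      obtain ⟨x, y, hxy, rfl⟩ := exists_lt_of_card_eq_two hc
      simp only [Finset.insert_subset_iff, Finset.singleton_subset_iff, Finset.mem_Icc] at hs
      rw [edge_mem_iff hp hbk hxy, pair_mem_removedEdges hxy]
      unfold IsEdge
      by_cases hR : (x = 1 ∧ y % 3 = 0 ∧ 6 ≤ y ∧ y ≤ 3 * b + 3) ∨
          (x = 2 ∧ y % 3 ≠ 1 ∧ 5 ≤ y ∧ y ≤ 3 * b + 3)
      · exact Or.inr hR
      · exact Or.inl ⟨by omega, hc⟩
  rw [← card_removedEdges b, ← Finset.card_union_of_disjoint hdisj, hunion,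
    Finset.card_powersetCard, Nat.card_Icc, Nat.add_sub_cancel]

/-- The vertices of `{ī, (i+1)¯, (i+2+3j)¯}` in increasing order. -/
def sortedTriple (p : ℕ) (q : ℕ × ℕ) : ℕ × ℕ × ℕ :=
  if q.1 + 1 = 3 * p then (1, 2 + 3 * q.2, q.1)
  else if q.1 + 2 + 3 * q.2 < 3 * p then (q.1, q.1 + 1, q.1 + 2 + 3 * q.2)
  else (q.1 + 3 + 3 * q.2 - 3 * p, q.1, q.1 + 1)

/-- The sorted triangles of `Δ(1,1),…,Δ(1,b)`. -/
def removedTriples (b : ℕ) : Finset (ℕ × ℕ × ℕ) :=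
  ((Finset.Icc 1 b).image fun j => (1, 2, 3 + 3 * j)) ∪
    ((Finset.Icc 1 b).image fun j => (2, 2 + 3 * j, 3 + 3 * j))

/-- The sorted triangles `G_{b+1},…,G_{b+k}`. -/
def addedTriples (b k : ℕ) : Finset (ℕ × ℕ × ℕ) :=
  (Finset.Icc (b + 1) (b + k)).image fun j => (1, 2 + 3 * j, 3 + 3 * j)

lemma mem_removedTriples {b x y z : ℕ} : (x, y, z) ∈ removedTriples b ↔
    (x = 1 ∧ y = 2 ∧ z % 3 = 0 ∧ 6 ≤ z ∧ z ≤ 3 * b + 3) ∨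
      (x = 2 ∧ z = y + 1 ∧ y % 3 = 2 ∧ 5 ≤ y ∧ y ≤ 3 * b + 2) := by
  simp only [removedTriples, Finset.mem_union, Finset.mem_image, Finset.mem_Icc, Prod.mk.injEq]
  constructor
  · rintro (⟨j, hj⟩ | ⟨j, hj⟩) <;> omega
  · rintro (h | h)
    · exact Or.inl ⟨(z - 3) / 3, by omega⟩
    · exact Or.inr ⟨(y - 2) / 3, by omega⟩

lemma mem_addedTriples {b k x y z : ℕ} : (x, y, z) ∈ addedTriples b k ↔
    x = 1 ∧ z = y + 1 ∧ y % 3 = 2 ∧ 3 * b + 5 ≤ y ∧ y ≤ 3 * (b + k) + 2 := by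
  simp only [addedTriples, Finset.mem_image, Finset.mem_Icc, Prod.mk.injEq]
  constructor
  · rintro ⟨j, hj⟩; omega
  · intro h
    exact ⟨(y - 2) / 3, by omega⟩

lemma card_removedTriples (b : ℕ) : (removedTriples b).card = 2 * b := by
  unfold removedTriples
  rw [Finset.card_union_of_disjoint, Finset.card_image_of_injective,
    Finset.card_image_of_injective, Nat.card_Icc]
  · omega
  · intro i j h; simp only [Prod.mk.injEq] at h; omega
  · intro i j h; simp only [Prod.mk.injEq] at h; omega
  · rw [Finset.disjoint_left]
    rintro ⟨x, y, z⟩ h h'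
    simp only [Finset.mem_image, Prod.mk.injEq] at h h'
    omega

lemma card_addedTriples (b k : ℕ) : (addedTriples b k).card = k := by
  unfold addedTriples
  rw [Finset.card_image_of_injective, Nat.card_Icc]
  · omega
  · intro i j h; simp only [Prod.mk.injEq] at h; omega

lemma mem_image_sortedTriple {p x y z : ℕ} (hp : 2 ≤ p) :
    (x, y, z) ∈ ((Finset.Icc 1 (3 * p - 1)) ×ˢ (Finset.range (p - 1))).image (sortedTriple p) ↔
      1 ≤ x ∧ x < y ∧ y < z ∧ z < 3 * p ∧ ((y = x + 1 ∧ z % 3 = (x + 2) % 3) ∨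
        (z = y + 1 ∧ x % 3 = y % 3) ∨ (x = 1 ∧ z + 1 = 3 * p ∧ y % 3 = 2)) := by
  simp only [Finset.mem_image, Finset.mem_product, Finset.mem_Icc, Finset.mem_range, Prod.exists,
    sortedTriple]
  constructor
  · rintro ⟨i, j, hij, h⟩
    split_ifs at h <;> simp only [Prod.mk.injEq] at h <;> omega
  · rintro ⟨h1, h2, h3, h4, h | h | h⟩
    · refine ⟨x, (z - x - 2) / 3, by omega, ?_⟩
      rw [if_neg (by omega), if_pos (by omega)]
      simp only [Prod.mk.injEq, true_and]; omega
    · refine ⟨y, p - 1 - (y - x) / 3, by omega, ?_⟩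
      rw [if_neg (by omega), if_neg (by omega)]
      simp only [Prod.mk.injEq, true_and]; omega
    · refine ⟨z, (y - 2) / 3, by omega, ?_⟩
      rw [if_pos (by omega)]
      simp only [Prod.mk.injEq, and_true]; omega

lemma card_image_sortedTriple (p : ℕ) :
    (((Finset.Icc 1 (3 * p - 1)) ×ˢ (Finset.range (p - 1))).image (sortedTriple p)).card =
      (3 * p - 1) * (p - 1) := by
  rw [Finset.card_image_of_injOn, Finset.card_product, Nat.card_Icc, Finset.card_range,
    Nat.add_sub_cancel]
  rintro ⟨i, j⟩ hij ⟨i', j'⟩ hij' h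
  simp only [Finset.coe_product, Set.mem_prod, Finset.mem_coe, Finset.mem_Icc,
    Finset.mem_range] at hij hij'
  simp only [sortedTriple] at h
  split_ifs at h <;> simp only [Prod.mk.injEq] at h ⊢ <;> omega

lemma card_facesOf_three {p b k : ℕ} (hp : 2 ≤ p) (hbk : b + k ≤ p - 2) :
    (facesOf (DeltaAk p b k) 3).card + 2 * b = (3 * p - 1) * (p - 1) + k := by
  classical
  set S := ((Finset.Icc 1 (3 * p - 1)) ×ˢ (Finset.range (p - 1))).image (sortedTriple p)
  set P := (S ∪ addedTriples b k) \ removedTriples b with hP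
  have hmem : ∀ x y z, (x, y, z) ∈ P ↔ IsTri p b k x y z := by
    intro x y z
    rw [hP, Finset.mem_sdiff, Finset.mem_union, mem_image_sortedTriple hp, mem_addedTriples,
      mem_removedTriples]
    constructor
    · rintro ⟨⟨h1, h2, h3, h4, h | h | h⟩ | h, hr⟩
      · exact isTri_low h1 h.1 h3 h4 h.2 (by omega)
      · exact isTri_high h1 h2 h.1 h4 h.2 (by omega)
      · exact isTri_wrap h.1 h2 h3 h.2.1 h.2.2
      · exact ⟨by omega, by omega, by omega, by omega, Or.inr (Or.inr (Or.inr h))⟩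
    · rintro ⟨h1, h2, h3, h4, h | h | h | h⟩
      · exact ⟨Or.inl ⟨h1, h2, h3, h4, Or.inl ⟨h.1, h.2.1⟩⟩, by omega⟩
      · exact ⟨Or.inl ⟨h1, h2, h3, h4, Or.inr (Or.inl ⟨h.1, h.2.1⟩)⟩, by omega⟩
      · exact ⟨Or.inl ⟨h1, h2, h3, h4, Or.inr (Or.inr h)⟩, by omega⟩
      · exact ⟨Or.inr h, by omega⟩
  have himage : facesOf (DeltaAk p b k) 3 = P.image fun t => {t.1, t.2.1, t.2.2} := by
    ext F
    simp only [facesOf, Finset.mem_filter, Finset.mem_image, Prod.exists, hmem]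
    constructor
    · rintro ⟨hF, hc⟩
      obtain ⟨x, y, z, h, hs⟩ := (mem_DeltaAk hp hbk).1 hF
      exact ⟨x, y, z, h, (Finset.eq_of_subset_of_card_le hs
        (by rw [hc, card_triple h.2.1 h.2.2.1])).symm⟩
    · rintro ⟨x, y, z, h, rfl⟩
      exact ⟨(mem_DeltaAk hp hbk).2 ⟨x, y, z, h, subset_rfl⟩, card_triple h.2.1 h.2.2.1⟩
  have hinj : Set.InjOn (fun t : ℕ × ℕ × ℕ => ({t.1, t.2.1, t.2.2} : Finset ℕ)) P := by
    rintro ⟨x, y, z⟩ h ⟨x', y', z'⟩ h' he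
    rw [Finset.mem_coe, hmem] at h h'
    obtain ⟨rfl, rfl, rfl⟩ := triple_eq_triple_of_lt h.2.1 h.2.2.1 h'.2.1 h'.2.2.1 he
    rfl
  have hsub : removedTriples b ⊆ S ∪ addedTriples b k := by
    rintro ⟨x, y, z⟩ h
    rw [mem_removedTriples] at h
    rw [Finset.mem_union, mem_image_sortedTriple hp]
    omega
  have hdisj : Disjoint S (addedTriples b k) := by
    rw [Finset.disjoint_left]
    rintro ⟨x, y, z⟩ h h'
    rw [mem_image_sortedTriple hp] at h
    rw [mem_addedTriples] at h'
    omega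
  have hcard := Finset.card_sdiff_add_card_eq_card hsub
  rw [Finset.card_union_of_disjoint hdisj, card_image_sortedTriple p, card_addedTriples,
    card_removedTriples] at hcard
  rw [himage, Finset.card_image_of_injOn hinj, hcard]

lemma DeltaAk_hVector3 {p b k : ℕ} (hp : 2 ≤ p) (hbk : b + k ≤ p - 2) :
    hVector3 (DeltaAk p b k) 1 (((3 * p - 1 : ℕ) : ℤ) - 3)
      (3 * ((((3 * p - 1 - 2).choose 2 / 3 : ℕ) : ℤ) - (b : ℤ)))
      (-((((3 * p - 1 - 2).choose 2 / 3 : ℕ) : ℤ) - (b : ℤ)) + (k : ℤ)) := by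
  obtain ⟨q, rfl⟩ := Nat.exists_eq_add_of_le' hp
  have h1 := card_facesOf_one hp hbk
  have h2 := card_facesOf_two hp hbk
  have h3 := card_facesOf_three hp hbk
  rw [show 3 * (q + 2) - 1 - 2 = 3 * q + 3 by omega]
  rw [show 3 * (q + 2) - 1 = 3 * q + 5 by omega] at h1 h2 h3 ⊢
  rw [show q + 2 - 1 = q + 1 by omega] at h3
  have hM : 2 * (3 * q + 3).choose 2 = (3 * q + 3) * (3 * q + 2) := by
    rw [Nat.choose_two_right, Nat.mul_div_cancel' (Nat.even_mul_pred_self _).two_dvd]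
    rfl
  have hE : 2 * (3 * q + 5).choose 2 = (3 * q + 5) * (3 * q + 4) := by
    rw [Nat.choose_two_right, Nat.mul_div_cancel' (Nat.even_mul_pred_self _).two_dvd]
    rfl
  have hdvd : 3 ∣ (3 * q + 3).choose 2 :=
    (show Nat.Coprime 3 2 by norm_num).dvd_of_dvd_mul_left
      (hM ▸ Dvd.dvd.mul_right ⟨q + 1, by ring⟩ _)
  obtain ⟨M, hM'⟩ := hdvd
  rw [hM', Nat.mul_div_cancel_left _ (by norm_num)]
  rw [hM'] at hM
  zify at h1 h2 h3 hM hE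
  simp only [hVector3, hVec, fVec, Finset.sum_range_succ, Finset.sum_range_zero]
  norm_num [Nat.choose_two_right]
  refine ⟨?_, ?_, ?_⟩ <;> nlinarith

end Counting

/-- **Lemma 3.3.** For `n = 3p-1`, `b + c ≤ p-2`, and `0 ≤ k ≤ c`, the complex `Δ_k`
is connected, Buchsbaum, and `h(Δ_k) = (1, n-3, 3(M-b), -(M-b)+k)`. -/
theorem stmt14 (K : Type) [Field K] (p b c : ℕ) (hp : 2 ≤ p) (hbc : b + c ≤ p - 2) :
    ∀ k ≤ c, IsConnectedComplex (DeltaAk p b k) ∧ IsBuchsbaum K (DeltaAk p b k) ∧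
      hVector3 (DeltaAk p b k) 1 (((3 * p - 1 : ℕ) : ℤ) - 3)
        (3 * ((((3 * p - 1 - 2).choose 2 / 3 : ℕ) : ℤ) - (b : ℤ))) (-((((3 * p - 1 - 2).choose 2 / 3 : ℕ) : ℤ) - (b : ℤ)) + (k : ℤ)) := by
  intro k hk
  have hbk : b + k ≤ p - 2 := by omega
  exact ⟨DeltaAk_connected hp hbk, DeltaAk_isBuchsbaum K hp hbk, DeltaAk_hVector3 hp hbk⟩
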